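/- arXiv:2512.17767 — 2 statements merged into one kernel-verified Lean document; each statement's English description precedes it below -/
import Mathlib

section
/- For every smooth solution (u, θ) of the thermoelastic system and every t ≥ 0, the total energy is conserved: (1/2)∫_Ω |u_t(t,x)|² dx + ((2μ+λ)/2)∫_Ω (div u(t,x))² dx + (μ/2)∫_Ω |curl u(t,x)|² dx + ∫_Ω θ(t,x) dx = (1/2)∫_Ω |v₀(x)|² dx + ((2μ+λ)/2)∫_Ω (div u₀(x))² dx + (μ/2)∫_Ω |curl u₀(x)|² dx + ∫_Ω θ₀(x) dx. -/
open MeasureTheory Real Filter Set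
open scoped Topology

noncomputable section

/-- Euclidean space `ℝ^d`. -/
abbrev Ed (d : ℕ) := EuclideanSpace ℝ (Fin d)

/-- Partial derivative of a scalar function in the `i`-th coordinate direction. -/
def pd {d : ℕ} (i : Fin d) (f : Ed d → ℝ) (x : Ed d) : ℝ :=
  fderiv ℝ f x (EuclideanSpace.single i 1)

/-- Divergence of a vector field. -/
def divg {d : ℕ} (w : Ed d → Ed d) (x : Ed d) : ℝ :=
  ∑ i, pd i (fun y => w y i) x

/-- Laplacian of a scalar function. -/
def lap {d : ℕ} (f : Ed d → ℝ) (x : Ed d) : ℝ :=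
  ∑ i, pd i (fun y => pd i f y) x

/-- Squared euclidean norm of the gradient of a scalar function. -/
def gradNormSq {d : ℕ} (f : Ed d → ℝ) (x : Ed d) : ℝ :=
  ∑ i, (pd i f x) ^ 2

/-- Squared Frobenius norm of the Hessian of a scalar function. -/
def hessNormSq {d : ℕ} (f : Ed d → ℝ) (x : Ed d) : ℝ :=
  ∑ i, ∑ j, (pd i (fun y => pd j f y) x) ^ 2

/-- The antisymmetric curl two-form `(curl w)ᵢⱼ = ∂ᵢ wⱼ - ∂ⱼ wᵢ`. -/
def curlM {d : ℕ} (w : Ed d → Ed d) (x : Ed d) (i j : Fin d) : ℝ :=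
  pd i (fun y => w y j) x - pd j (fun y => w y i) x

/-- `|curl w|²`: in dimension 2 (scalar curl) and 3 (vector curl) this equals
the squared norm of the curl. -/
def curlNormSq {d : ℕ} (w : Ed d → Ed d) (x : Ed d) : ℝ :=
  (1 / 2) * ∑ i, ∑ j, (curlM w x i j) ^ 2

/-- `j`-th component of `curl curl w` (in dimensions 2 and 3 this is
`∑ i ∂ᵢ (∂ⱼ wᵢ - ∂ᵢ wⱼ) = ∂ⱼ (div w) - Δ wⱼ`). -/
def ccurl {d : ℕ} (w : Ed d → Ed d) (x : Ed d) (j : Fin d) : ℝ :=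
  ∑ i, pd i (fun y => curlM w y j i) x

/-- `j`-th component of the componentwise Laplacian of a vector field. -/
def veclap {d : ℕ} (w : Ed d → Ed d) (x : Ed d) (j : Fin d) : ℝ :=
  ∑ i, pd i (fun y => pd i (fun z => w z j) y) x

/-- Time derivative of a time-dependent field. -/
def tder {α : Type*} {F : Type*} [NormedAddCommGroup F] [NormedSpace ℝ F]
    (u : ℝ → α → F) : ℝ → α → F :=
  fun t x => deriv (fun s => u s x) t

/-- An open, bounded, convex domain in `ℝ^d` (`d ∈ {2,3}`) together with its outward
unit normal field `n` on the boundary.  For a convex body with smooth boundary the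
outward unit normal at a boundary point is characterized by the supporting
half-space inequality. -/
structure GoodDomain (d : ℕ) (Ω : Set (Ed d)) (n : Ed d → Ed d) : Prop where
  dims : d = 2 ∨ d = 3
  isOpen : IsOpen Ω
  bounded : Bornology.IsBounded Ω
  convex : Convex ℝ Ω
  nonempty : Ω.Nonempty
  normal_unit : ∀ x ∈ frontier Ω, ‖n x‖ = 1
  normal_outward : ∀ x ∈ frontier Ω, ∀ y ∈ closure Ω, ∑ i, (y i - x i) * n x i ≤ 0

/-- A smooth solution `(u, θ)` of the thermoelastic system
`u_tt - (2μ+λ)∇(div u) + μ curl curl u = -ν∇θ`, `θ_t - Δθ = -ν θ div u_t`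
with boundary conditions `u·n = 0`, `𝒩u = 0` (encoded as `(curl u) n = 0`,
which in dimension 2 means `curl u = 0` and in dimension 3 means
`curl u × n = 0`) and `∇θ·n = 0`, and with positive temperature. -/
structure IsSolution {d : ℕ} (Ω : Set (Ed d)) (n : Ed d → Ed d)
    (μ lam ν : ℝ) (u : ℝ → Ed d → Ed d) (θ : ℝ → Ed d → ℝ) : Prop where
  smooth_u : ContDiff ℝ (⊤ : ℕ∞) (fun p : ℝ × Ed d => u p.1 p.2)
  smooth_θ : ContDiff ℝ (⊤ : ℕ∞) (fun p : ℝ × Ed d => θ p.1 p.2)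
  theta_pos : ∀ t : ℝ, 0 ≤ t → ∀ x ∈ closure Ω, 0 < θ t x
  wave : ∀ t : ℝ, 0 < t → ∀ x ∈ Ω, ∀ j : Fin d,
    tder (tder u) t x j - (2 * μ + lam) * pd j (divg (u t)) x
      + μ * ccurl (u t) x j = -ν * pd j (θ t) x
  heat : ∀ t : ℝ, 0 < t → ∀ x ∈ Ω,
    tder θ t x - lap (θ t) x = -ν * θ t x * divg (tder u t) x
  bc_u : ∀ t : ℝ, 0 < t → ∀ x ∈ frontier Ω, ∑ i, u t x i * n x i = 0
  bc_N : ∀ t : ℝ, 0 < t → ∀ x ∈ frontier Ω, ∀ i : Fin d,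
    ∑ j, curlM (u t) x i j * n x j = 0
  bc_θ : ∀ t : ℝ, 0 < t → ∀ x ∈ frontier Ω, ∑ i, pd i (θ t) x * n x i = 0

/-- The functional `F(u, u_t, θ)` built from the Fisher information and
higher-order derivatives of the displacement. -/
def Ffun {d : ℕ} (Ω : Set (Ed d)) (μ lam : ℝ)
    (u : ℝ → Ed d → Ed d) (θ : ℝ → Ed d → ℝ) (t : ℝ) : ℝ :=
  (1 / 2) * ((∫ x in Ω, (divg (tder u t) x) ^ 2)
    + (∫ x in Ω, curlNormSq (tder u t) x)
    + (2 * μ + lam) * (∫ x in Ω, gradNormSq (divg (u t)) x)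
    + μ * (∫ x in Ω, ∑ j, (ccurl (u t) x j) ^ 2)
    + (∫ x in Ω, gradNormSq (θ t) x / θ t x))

/-- The small-data condition
`‖div v₀‖² + ‖curl v₀‖² + (2μ+λ)‖∇div u₀‖² + μ‖curl curl u₀‖² + ‖∇θ₀/√θ₀‖² ≤ D`. -/
def smallData {d : ℕ} (Ω : Set (Ed d)) (μ lam : ℝ)
    (u0 v0 : Ed d → Ed d) (θ0 : Ed d → ℝ) (D : ℝ) : Prop :=
  (∫ x in Ω, (divg v0 x) ^ 2) + (∫ x in Ω, curlNormSq v0 x)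
    + (2 * μ + lam) * (∫ x in Ω, gradNormSq (divg u0) x)
    + μ * (∫ x in Ω, ∑ j, (ccurl u0 x j) ^ 2)
    + (∫ x in Ω, gradNormSq θ0 x / θ0 x) ≤ D

/-- The norm `‖w‖_H = (‖div w‖² + ‖curl w‖²)^{1/2}`. -/
def Hnorm {d : ℕ} (Ω : Set (Ed d)) (w : Ed d → Ed d) : ℝ :=
  Real.sqrt ((∫ x in Ω, (divg w x) ^ 2) + (∫ x in Ω, curlNormSq w x))

end

open scoped NNReal ContDiff

namespace GoodDomain

variable {d : ℕ} {Ω : Set (Ed d)} {n : Ed d → Ed d}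

theorem compl_nonempty (h : GoodDomain d Ω n) : Ωᶜ.Nonempty := by
  have : Nonempty (Fin d) := by
    rcases h.dims with rfl | rfl <;> infer_instance
  have : Nontrivial (Ed d) := inferInstance
  rw [Set.nonempty_compl]
  rintro rfl
  exact NormedSpace.unbounded_univ ℝ (Ed d) h.bounded

theorem inner_normal_le (h : GoodDomain d Ω n) {x y : Ed d} (hx : x ∈ frontier Ω)
    (hy : y ∈ closure Ω) : inner ℝ (n x) (y - x) ≤ 0 := by
  simpa [PiLp.inner_apply] using h.normal_outward x hx y hy

/-- The distance to the complement is bounded by the distance to any supporting hyperplane. -/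
theorem infDist_compl_le (h : GoodDomain d Ω n) {x y : Ed d} (hx : x ∈ Ω)
    (hy : y ∈ frontier Ω) : Metric.infDist x Ωᶜ ≤ inner ℝ (n y) (y - x) := by
  have hpos : 0 < Metric.infDist x Ωᶜ :=
    (h.isOpen.isClosed_compl.notMem_iff_infDist_pos h.compl_nonempty).1 (by simpa using hx)
  have hmem : x + Metric.infDist x Ωᶜ • n y ∈ closure Ω := by
    refine closure_mono (Metric.ball_infDist_compl_subset (x := x)) ?_
    rw [closure_ball x hpos.ne']
    simp [norm_smul, h.normal_unit y hy, abs_of_pos hpos]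
  have := h.inner_normal_le hy hmem
  rw [show x + Metric.infDist x Ωᶜ • n y - y = Metric.infDist x Ωᶜ • n y - (y - x) by abel,
    inner_sub_right, inner_smul_right, real_inner_self_eq_norm_sq, h.normal_unit y hy] at this
  linarith

theorem exists_frontier_infDist_eq (h : GoodDomain d Ω n) {x : Ed d} (hx : x ∈ Ω) :
    ∃ y ∈ frontier Ω, Metric.infDist x Ωᶜ = dist x y := by
  obtain ⟨y, hy, hxy⟩ := h.isOpen.isClosed_compl.exists_infDist_eq_dist h.compl_nonempty x
  refine ⟨y, ?_, hxy⟩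
  have hpos : 0 < Metric.infDist x Ωᶜ :=
    (h.isOpen.isClosed_compl.notMem_iff_infDist_pos h.compl_nonempty).1 (by simpa using hx)
  rw [h.isOpen.frontier_eq]
  refine ⟨closure_mono (Metric.ball_infDist_compl_subset (x := x)) ?_, hy⟩
  rw [closure_ball x hpos.ne', Metric.mem_closedBall, hxy, dist_comm]

end GoodDomain

/-- The Lipschitz cutoff `min(1, k dist(x, Ωᶜ))`. -/
noncomputable def distCutoff {d : ℕ} (Ω : Set (Ed d)) (k : ℝ≥0) (x : Ed d) : ℝ :=
  min 1 (k * Metric.infDist x Ωᶜ)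

section Cutoff

variable {d : ℕ} {Ω : Set (Ed d)} {n : Ed d → Ed d}

theorem lipschitzWith_distCutoff (k : ℝ≥0) : LipschitzWith k (distCutoff Ω k) := by
  refine LipschitzWith.const_min ?_ 1
  refine LipschitzWith.of_dist_le_mul fun x y => ?_
  have := (Metric.lipschitz_infDist_pt Ωᶜ).dist_le_mul x y
  rw [Real.dist_eq, ← mul_sub, abs_mul, abs_of_nonneg k.coe_nonneg, ← Real.dist_eq]
  simp only [NNReal.coe_one, one_mul] at this
  exact mul_le_mul_of_nonneg_left this k.2

theorem distCutoff_nonneg (k : ℝ≥0) (x : Ed d) : 0 ≤ distCutoff Ω k x :=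
  le_min zero_le_one (mul_nonneg k.2 Metric.infDist_nonneg)

theorem distCutoff_le_one (k : ℝ≥0) (x : Ed d) : distCutoff Ω k x ≤ 1 := min_le_left _ _

theorem distCutoff_of_notMem (k : ℝ≥0) {x : Ed d} (hx : x ∉ Ω) : distCutoff Ω k x = 0 := by
  simp [distCutoff, Metric.infDist_zero_of_mem (show x ∈ Ωᶜ from hx)]

theorem fderiv_distCutoff_of_notMem (k : ℝ≥0) {x : Ed d} (hx : x ∉ Ω) :
    fderiv ℝ (distCutoff Ω k) x = 0 := by
  apply IsLocalMin.fderiv_eq_zero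
  filter_upwards with y
  rw [distCutoff_of_notMem k hx]
  exact distCutoff_nonneg k y

theorem fderiv_distCutoff_of_one_le {k : ℝ≥0} {x : Ed d} (hx : 1 ≤ k * Metric.infDist x Ωᶜ) :
    fderiv ℝ (distCutoff Ω k) x = 0 := by
  apply IsLocalMax.fderiv_eq_zero
  filter_upwards with y
  rw [show distCutoff Ω k x = 1 from min_eq_left hx]
  exact distCutoff_le_one k y

/-- At an interior point close to the boundary, the gradient of the cutoff is a multiple of the
normal at a nearest boundary point. -/
theorem fderiv_distCutoff_of_le (h : GoodDomain d Ω n) {k : ℝ≥0} {x y : Ed d} (hx : x ∈ Ω)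
    (hk : k * Metric.infDist x Ωᶜ ≤ 1) (hy : y ∈ frontier Ω)
    (hxy : Metric.infDist x Ωᶜ = dist x y) (hd : DifferentiableAt ℝ (distCutoff Ω k) x) (v : Ed d) :
    fderiv ℝ (distCutoff Ω k) x v = - (k * inner ℝ (n y) v) := by
  let ℓ : Ed d → ℝ := fun z => k * inner ℝ (n y) (y - z)
  have hℓ : HasFDerivAt ℓ (-((k : ℝ) • innerSL ℝ (n y))) x := by
    have h1 : HasFDerivAt (fun z => innerSL ℝ (n y) (y - z))
        ((innerSL ℝ (n y)).comp (-ContinuousLinearMap.id ℝ (Ed d))) x :=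
      (innerSL ℝ (n y)).hasFDerivAt.comp x ((hasFDerivAt_id x).const_sub y)
    refine (h1.const_mul (k : ℝ)).congr_fderiv ?_
    ext w
    simp
  have hmin : IsLocalMin (fun z => ℓ z - distCutoff Ω k z) x := by
    filter_upwards [h.isOpen.mem_nhds hx] with z hz
    have h1 : distCutoff Ω k z ≤ ℓ z := (min_le_right _ _).trans
      (mul_le_mul_of_nonneg_left (h.infDist_compl_le hz hy) k.2)
    have h2 : ℓ x ≤ distCutoff Ω k x := by
      rw [distCutoff, min_eq_right hk, hxy]
      refine mul_le_mul_of_nonneg_left ?_ k.2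
      refine (real_inner_le_norm _ _).trans ?_
      rw [h.normal_unit y hy, one_mul, dist_comm, dist_eq_norm]
    linarith
  have := hmin.hasFDerivAt_eq_zero (hℓ.sub hd.hasFDerivAt)
  have := congrArg (fun L => L v) this
  simp at this
  linarith

end Cutoff

section Divergence

variable {d : ℕ} {Ω : Set (Ed d)} {n : Ed d → Ed d} {F : Fin d → Ed d → ℝ}

theorem hasCompactSupport_distCutoff (hΩ : Bornology.IsBounded Ω) (k : ℝ≥0) :
    HasCompactSupport (distCutoff Ω k) :=
  HasCompactSupport.intro hΩ.isCompact_closure fun _ hx =>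
    distCutoff_of_notMem k fun h => hx (subset_closure h)

theorem ContDiff.continuous_pd {f : Ed d → ℝ} (hf : ContDiff ℝ 1 f) (i : Fin d) :
    Continuous (pd i f) :=
  (hf.continuous_fderiv one_ne_zero).clm_apply continuous_const

/-- For a field tangent to the boundary, its product with the gradient of the cutoff is bounded
independently of the cutoff parameter. -/
theorem abs_sum_mul_fderiv_distCutoff_le (h : GoodDomain d Ω n) {C : Fin d → ℝ≥0}
    (hF : ∀ i, LipschitzWith (C i) (F i)) (hn : ∀ x ∈ frontier Ω, ∑ i, F i x * n x i = 0)
    {k : ℝ≥0} {x : Ed d} (hd : DifferentiableAt ℝ (distCutoff Ω k) x) :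
    |∑ i, fderiv ℝ (distCutoff Ω k) x (EuclideanSpace.single i 1) * F i x|
      ≤ Ω.indicator (fun _ => ∑ i, (C i : ℝ)) x := by
  have hC : 0 ≤ ∑ i, (C i : ℝ) := Finset.sum_nonneg fun i _ => (C i).2
  by_cases hx : x ∈ Ω
  swap
  · simp [fderiv_distCutoff_of_notMem k hx, hx]
  rw [Set.indicator_of_mem hx]
  rcases le_total 1 (k * Metric.infDist x Ωᶜ) with hk | hk
  · simpa [fderiv_distCutoff_of_one_le hk] using hC
  obtain ⟨y, hy, hxy⟩ := h.exists_frontier_infDist_eq hx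
  have hcomp : ∀ i, |n y i| ≤ 1 := fun i => by
    simpa [h.normal_unit y hy] using PiLp.norm_apply_le (n y) i
  have key : ∑ i, fderiv ℝ (distCutoff Ω k) x (EuclideanSpace.single i 1) * F i x
      = ∑ i, -(k * (n y i * (F i x - F i y))) := by
    have h0 : ∑ i, (k : ℝ) * (F i y * n y i) = 0 := by rw [← Finset.mul_sum, hn y hy, mul_zero]
    rw [← add_zero (∑ i, _ * F i x), ← h0, ← Finset.sum_add_distrib]
    refine Finset.sum_congr rfl fun i _ => ?_
    rw [fderiv_distCutoff_of_le h hx hk hy hxy hd, EuclideanSpace.inner_single_right]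
    simp
    ring
  rw [key]
  refine (Finset.abs_sum_le_sum_abs _ _).trans (Finset.sum_le_sum fun i _ => ?_)
  rw [abs_neg, abs_mul, abs_mul, abs_of_nonneg k.coe_nonneg]
  have h1 : |F i x - F i y| ≤ C i * dist x y := (hF i).dist_le_mul x y
  rw [hxy] at hk
  calc (k : ℝ) * (|n y i| * |F i x - F i y|) ≤ k * (1 * (C i * dist x y)) := by
        gcongr
        exact hcomp i
    _ = C i * (k * dist x y) := by ring
    _ ≤ C i * 1 := by gcongr
    _ = C i := mul_one _

theorem tendsto_distCutoff (h : GoodDomain d Ω n) (x : Ed d) :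
    Tendsto (fun k : ℕ => distCutoff Ω (k : ℝ≥0) x) atTop (𝓝 (Ω.indicator 1 x)) := by
  by_cases hx : x ∈ Ω
  swap
  · simp [distCutoff_of_notMem _ hx, hx]
  have hpos : 0 < Metric.infDist x Ωᶜ :=
    (h.isOpen.isClosed_compl.notMem_iff_infDist_pos h.compl_nonempty).1 (by simpa using hx)
  refine tendsto_const_nhds.congr' ?_
  filter_upwards [(tendsto_natCast_atTop_atTop.atTop_mul_const hpos).eventually_ge_atTop (1 : ℝ)]
    with k hk
  simp [distCutoff, hx, hk]

theorem eventually_fderiv_distCutoff_eq_zero (h : GoodDomain d Ω n) (x : Ed d) :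
    ∀ᶠ k : ℕ in atTop, fderiv ℝ (distCutoff Ω (k : ℝ≥0)) x = 0 := by
  by_cases hx : x ∈ Ω
  swap
  · simp [fderiv_distCutoff_of_notMem _ hx]
  have hpos : 0 < Metric.infDist x Ωᶜ :=
    (h.isOpen.isClosed_compl.notMem_iff_infDist_pos h.compl_nonempty).1 (by simpa using hx)
  filter_upwards [(tendsto_natCast_atTop_atTop.atTop_mul_const hpos).eventually_ge_atTop (1 : ℝ)]
    with k hk
  exact fderiv_distCutoff_of_one_le (by simpa using hk)

theorem integral_sum_pd_mul_distCutoff (hΩ : Bornology.IsBounded Ω)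
    (hF : ∀ i, ContDiff ℝ 1 (F i)) (hc : ∀ i, HasCompactSupport (F i)) (k : ℝ≥0) :
    ∫ x, (∑ i, pd i (F i) x) * distCutoff Ω k x
      = -∫ x, ∑ i, lineDeriv ℝ (distCutoff Ω k) x (EuclideanSpace.single i 1) * F i x := by
  have hφ := lipschitzWith_distCutoff (Ω := Ω) k
  have hφc := hasCompactSupport_distCutoff hΩ k
  simp_rw [Finset.sum_mul]
  rw [integral_finsetSum, integral_finsetSum, ← Finset.sum_neg_distrib]
  · refine Finset.sum_congr rfl fun i _ => ?_
    obtain ⟨C, hC⟩ := (hF i).lipschitzWith_of_hasCompactSupport (hc i) one_ne_zero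
    have := hC.integral_lineDeriv_mul_eq (μ := volume) hφ hφc (EuclideanSpace.single i 1)
    simp_rw [lineDeriv_neg, neg_mul, integral_neg] at this
    rw [← this]
    refine integral_congr_ae (.of_forall fun x => ?_)
    simp only [pd]
    rw [((hF i).differentiable one_ne_zero x).lineDeriv_eq_fderiv]
  · intro i _
    exact (((hF i).continuous.integrable_of_hasCompactSupport (hc i)).bdd_mul
      (aestronglyMeasurable_lineDeriv hφ.continuous _)
      (.of_forall fun x => norm_lineDeriv_le_of_lipschitz ℝ hφ))
  · intro i _
    exact (((hF i).continuous_pd i).mul hφ.continuous).integrable_of_hasCompactSupport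
      hφc.mul_left

theorem integral_sum_pd_eq_zero_of_hasCompactSupport (h : GoodDomain d Ω n)
    (hF : ∀ i, ContDiff ℝ 1 (F i)) (hc : ∀ i, HasCompactSupport (F i))
    (hn : ∀ x ∈ frontier Ω, ∑ i, F i x * n x i = 0) :
    ∫ x in Ω, ∑ i, pd i (F i) x = 0 := by
  choose C hC using fun i => (hF i).lipschitzWith_of_hasCompactSupport (hc i) one_ne_zero
  have hφ := fun k => lipschitzWith_distCutoff (Ω := Ω) k
  have hcont : Continuous fun x => ∑ i, pd i (F i) x :=
    continuous_finsetSum _ fun i _ => (hF i).continuous_pd i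
  have hint : Integrable fun x => ∑ i, pd i (F i) x :=
    integrable_finsetSum _ fun i _ => ((hF i).continuous_pd i).integrable_of_hasCompactSupport
      ((hc i).fderiv_apply ℝ _)
  have hleft : Tendsto (fun k : ℕ => ∫ x, (∑ i, pd i (F i) x) * distCutoff Ω (k : ℝ≥0) x) atTop
      (𝓝 (∫ x, (∑ i, pd i (F i) x) * Ω.indicator 1 x)) := by
    refine tendsto_integral_of_dominated_convergence _
      (fun k => (hcont.mul (hφ k).continuous).aestronglyMeasurable) hint.norm
      (fun k => .of_forall fun x => ?_)
      (.of_forall fun x => (tendsto_distCutoff h x).const_mul _)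
    rw [norm_mul, Real.norm_of_nonneg (distCutoff_nonneg _ x)]
    exact mul_le_of_le_one_right (norm_nonneg _) (distCutoff_le_one _ x)
  have hright : Tendsto (fun k : ℕ => ∫ x, ∑ i,
      lineDeriv ℝ (distCutoff Ω (k : ℝ≥0)) x (EuclideanSpace.single i 1) * F i x) atTop
      (𝓝 (∫ _ : Ed d, (0 : ℝ))) := by
    have hdiff : ∀ᵐ x : Ed d, ∀ k : ℕ, DifferentiableAt ℝ (distCutoff Ω (k : ℝ≥0)) x :=
      ae_all_iff.2 fun k => (hφ k).ae_differentiableAt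
    refine tendsto_integral_of_dominated_convergence
      (Ω.indicator fun _ => ∑ i, (C i : ℝ)) (fun k => ?_) ?_ (fun k => ?_) ?_
    · refine Finset.aestronglyMeasurable_fun_sum _ fun i _ => ?_
      exact (aestronglyMeasurable_lineDeriv (hφ k).continuous _).mul
        (hF i).continuous.aestronglyMeasurable
    · rw [integrable_indicator_iff h.isOpen.measurableSet]
      exact integrableOn_const h.bounded.measure_lt_top.ne
    · filter_upwards [hdiff] with x hx
      simp_rw [(hx k).lineDeriv_eq_fderiv]
      exact abs_sum_mul_fderiv_distCutoff_le h hC hn (hx k)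
    · filter_upwards [hdiff] with x hx
      refine tendsto_const_nhds.congr' ?_
      filter_upwards [eventually_fderiv_distCutoff_eq_zero h x] with k hk
      simp [(hx k).lineDeriv_eq_fderiv, hk]
  have hlim := tendsto_nhds_unique hleft
    (hright.neg.congr fun k => (integral_sum_pd_mul_distCutoff h.bounded hF hc k).symm)
  rw [← integral_indicator h.isOpen.measurableSet]
  rw [integral_zero, neg_zero] at hlim
  rw [← hlim]
  refine integral_congr_ae (.of_forall fun x => ?_)
  by_cases hx : x ∈ Ω <;> simp [hx]

/-- The divergence theorem for a `C¹` field which is tangent to the boundary. -/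
theorem GoodDomain.integral_sum_pd_eq_zero (h : GoodDomain d Ω n)
    (hF : ∀ i, ContDiff ℝ 1 (F i)) (hn : ∀ x ∈ frontier Ω, ∑ i, F i x * n x i = 0) :
    ∫ x in Ω, ∑ i, pd i (F i) x = 0 := by
  obtain ⟨R, hR⟩ := h.bounded.subset_closedBall (0 : Ed d)
  let χ : ContDiffBump (0 : Ed d) :=
    ⟨max R 0 + 1, max R 0 + 2, by positivity, by linarith⟩
  have hone : ∀ x ∈ closure Ω, χ =ᶠ[𝓝 x] 1 := fun x hx => by
    refine χ.eventuallyEq_one_of_mem_ball ?_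
    have : x ∈ Metric.closedBall (0 : Ed d) R :=
      Metric.isClosed_closedBall.closure_subset_iff.2 hR hx
    rw [Metric.mem_closedBall] at this
    rw [Metric.mem_ball]
    exact this.trans_lt ((le_max_left R 0).trans_lt (lt_add_one _))
  have key := integral_sum_pd_eq_zero_of_hasCompactSupport h (F := fun i x => χ x * F i x)
    (fun i => χ.contDiff.mul (hF i)) (fun i => χ.hasCompactSupport.mul_right) (fun x hx => by
      simpa [(hone x (frontier_subset_closure hx)).eq_of_nhds] using hn x hx)
  rw [← key]
  refine setIntegral_congr_fun h.isOpen.measurableSet fun x hx => ?_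
  refine Finset.sum_congr rfl fun i _ => ?_
  have : (fun y => χ y * F i y) =ᶠ[𝓝 x] F i := by
    filter_upwards [hone x (subset_closure hx)] with y hy
    simp [hy]
  simp only [pd, this.fderiv_eq]

end Divergence

/-- A time-dependent scalar field which is smooth in space and time. -/
def SmoothField {d : ℕ} (f : ℝ → Ed d → ℝ) : Prop :=
  ContDiff ℝ ∞ fun p : ℝ × Ed d => f p.1 p.2

namespace SmoothField

variable {d : ℕ} {Ω : Set (Ed d)} {f g : ℝ → Ed d → ℝ}

theorem add (hf : SmoothField f) (hg : SmoothField g) : SmoothField fun t x => f t x + g t x :=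
  ContDiff.add hf hg

theorem sub (hf : SmoothField f) (hg : SmoothField g) : SmoothField fun t x => f t x - g t x :=
  ContDiff.sub hf hg

theorem mul (hf : SmoothField f) (hg : SmoothField g) : SmoothField fun t x => f t x * g t x :=
  ContDiff.mul hf hg

theorem pow (hf : SmoothField f) (k : ℕ) : SmoothField fun t x => f t x ^ k :=
  ContDiff.pow hf k

theorem const_mul (c : ℝ) (hf : SmoothField f) : SmoothField fun t x => c * f t x :=
  ContDiff.mul contDiff_const hf

theorem sum {ι : Type*} {s : Finset ι} {f : ι → ℝ → Ed d → ℝ}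
    (hf : ∀ i, SmoothField (f i)) : SmoothField fun t x => ∑ i ∈ s, f i t x :=
  ContDiff.sum fun i _ => hf i

theorem slice (hf : SmoothField f) (t : ℝ) : ContDiff ℝ ∞ (f t) :=
  ContDiff.comp (g := fun p : ℝ × Ed d => f p.1 p.2) hf (contDiff_const.prodMk contDiff_id)

theorem differentiableAt_slice (hf : SmoothField f) (t : ℝ) (x : Ed d) :
    DifferentiableAt ℝ (f t) x :=
  (hf.slice t).differentiable (by simp) x

theorem hasFDerivAt (hf : SmoothField f) (p : ℝ × Ed d) :
    HasFDerivAt (fun p : ℝ × Ed d => f p.1 p.2)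
      (fderiv ℝ (fun p : ℝ × Ed d => f p.1 p.2) p) p :=
  (ContDiff.differentiable hf (by simp) p).hasFDerivAt

theorem pd_eq_fderiv (hf : SmoothField f) (i : Fin d) (t : ℝ) (x : Ed d) :
    pd i (f t) x
      = fderiv ℝ (fun p : ℝ × Ed d => f p.1 p.2) (t, x) (0, EuclideanSpace.single i 1) := by
  have h : HasFDerivAt (fun y : Ed d => ((t, y) : ℝ × Ed d)) (.inr ℝ ℝ (Ed d)) x :=
    hasFDerivAt_prodMk_right t x
  have h2 : HasFDerivAt (f t) _ x := (hf.hasFDerivAt (t, x)).comp x h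
  rw [pd, h2.fderiv]
  simp

theorem hasDerivAt_fderiv (hf : SmoothField f) (t : ℝ) (x : Ed d) :
    HasDerivAt (fun s => f s x) (fderiv ℝ (fun p : ℝ × Ed d => f p.1 p.2) (t, x) (1, 0)) t := by
  have h : HasFDerivAt (fun s : ℝ => ((s, x) : ℝ × Ed d)) (.inl ℝ ℝ (Ed d)) t :=
    hasFDerivAt_prodMk_left t x
  simpa [Function.comp_def] using ((hf.hasFDerivAt (t, x)).comp t h).hasDerivAt

theorem tder_eq_fderiv (hf : SmoothField f) (t : ℝ) (x : Ed d) :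
    tder f t x = fderiv ℝ (fun p : ℝ × Ed d => f p.1 p.2) (t, x) (1, 0) :=
  (hf.hasDerivAt_fderiv t x).deriv

theorem hasDerivAt (hf : SmoothField f) (t : ℝ) (x : Ed d) :
    HasDerivAt (fun s => f s x) (tder f t x) t :=
  hf.tder_eq_fderiv t x ▸ hf.hasDerivAt_fderiv t x

theorem fderiv_apply (hf : SmoothField f) (v : ℝ × Ed d) :
    SmoothField fun t x => fderiv ℝ (fun p : ℝ × Ed d => f p.1 p.2) (t, x) v :=
  (ContDiff.fderiv_right (m := ∞) hf (by simp)).clm_apply contDiff_const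

theorem pd (hf : SmoothField f) (i : Fin d) : SmoothField fun t x => pd i (f t) x := by
  simp_rw [hf.pd_eq_fderiv]
  exact hf.fderiv_apply _

theorem tder (hf : SmoothField f) : SmoothField (tder f) := by
  rw [show _root_.tder f = _ from funext₂ hf.tder_eq_fderiv]
  exact hf.fderiv_apply _

/-- Time and space derivatives commute. -/
theorem tder_pd (hf : SmoothField f) (i : Fin d) (t : ℝ) (x : Ed d) :
    _root_.tder (fun t x => _root_.pd i (f t) x) t x = _root_.pd i (_root_.tder f t) x := by
  have hsymm : IsSymmSndFDerivAt ℝ (fun p : ℝ × Ed d => f p.1 p.2) (t, x) :=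
    (ContDiff.contDiffAt hf).isSymmSndFDerivAt (by
      simpa using WithTop.coe_le_coe.2 (le_top (a := (2 : ℕ∞))))
  have hd : DifferentiableAt ℝ (fderiv ℝ fun p : ℝ × Ed d => f p.1 p.2) (t, x) :=
    (ContDiff.fderiv_right (m := ∞) hf (by simp)).differentiable (by simp) _
  have hsnd : ∀ v w : ℝ × Ed d,
      fderiv ℝ (fun p : ℝ × Ed d => fderiv ℝ (fun p : ℝ × Ed d => f p.1 p.2) p v) (t, x) w
        = fderiv ℝ (fderiv ℝ fun p : ℝ × Ed d => f p.1 p.2) (t, x) w v := fun v w => by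
    rw [fderiv_clm_apply hd (differentiableAt_const v)]
    simp
  rw [(hf.pd i).tder_eq_fderiv, hf.tder.pd_eq_fderiv]
  simp_rw [hf.pd_eq_fderiv, hf.tder_eq_fderiv]
  rw [hsnd, hsnd, hsymm.eq]

theorem integrableOn (hf : SmoothField f) (hΩ : Bornology.IsBounded Ω) (t : ℝ) :
    IntegrableOn (f t) Ω :=
  ((hf.slice t).continuous.continuousOn.integrableOn_compact hΩ.isCompact_closure).mono_set
    subset_closure

/-- Differentiation under the integral sign over a bounded set. -/
theorem hasDerivAt_integral (hf : SmoothField f) (hm : MeasurableSet Ω)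
    (hΩ : Bornology.IsBounded Ω) (t : ℝ) :
    HasDerivAt (fun s => ∫ x in Ω, f s x) (∫ x in Ω, _root_.tder f t x) t := by
  obtain ⟨C, hC⟩ := ((isCompact_Icc (a := t - 1) (b := t + 1)).prod
    hΩ.isCompact_closure).exists_bound_of_continuousOn (ContDiff.continuous hf.tder).continuousOn
  refine (hasDerivAt_integral_of_dominated_loc_of_deriv_le (bound := fun _ => C)
    (Icc_mem_nhds (sub_one_lt t) (lt_add_one t))
    (.of_forall fun s => (hf.slice s).continuous.aestronglyMeasurable) (hf.integrableOn hΩ t)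
    (hf.tder.slice t).continuous.aestronglyMeasurable ?_ ?_
    (.of_forall fun x s _ => hf.hasDerivAt s x)).2
  · exact ae_restrict_of_forall_mem hm fun x hx s hs => hC (s, x) ⟨hs, subset_closure hx⟩
  · exact integrableOn_const hΩ.measure_lt_top.ne

end SmoothField

section PartialDerivatives

variable {d : ℕ} {f g : Ed d → ℝ} {x : Ed d}

theorem pd_add (i : Fin d) (hf : DifferentiableAt ℝ f x) (hg : DifferentiableAt ℝ g x) :
    pd i (fun y => f y + g y) x = pd i f x + pd i g x := by
  simp [pd, fderiv_fun_add hf hg]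

theorem pd_sub (i : Fin d) (hf : DifferentiableAt ℝ f x) (hg : DifferentiableAt ℝ g x) :
    pd i (fun y => f y - g y) x = pd i f x - pd i g x := by
  simp [pd, fderiv_fun_sub hf hg]

theorem pd_mul (i : Fin d) (hf : DifferentiableAt ℝ f x) (hg : DifferentiableAt ℝ g x) :
    pd i (fun y => f y * g y) x = pd i f x * g x + f x * pd i g x := by
  simp [pd, fderiv_fun_mul hf hg]
  ring

theorem pd_const_mul (i : Fin d) (c : ℝ) (hf : DifferentiableAt ℝ f x) :
    pd i (fun y => c * f y) x = c * pd i f x := by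
  simp [pd, fderiv_const_mul hf]

theorem pd_sum (i : Fin d) {ι : Type*} {s : Finset ι} {f : ι → Ed d → ℝ}
    (hf : ∀ k, DifferentiableAt ℝ (f k) x) :
    pd i (fun y => ∑ k ∈ s, f k y) x = ∑ k ∈ s, pd i (f k) x := by
  simp [pd, fderiv_fun_sum fun k _ => hf k]

end PartialDerivatives

/-- The density of the total energy. -/
noncomputable def energyDensity {d : ℕ} (μ lam : ℝ) (u : ℝ → Ed d → Ed d) (θ : ℝ → Ed d → ℝ)
    (t : ℝ) (x : Ed d) : ℝ :=
  (1 / 2) * ∑ i, (tder u t x i) ^ 2 + ((2 * μ + lam) / 2) * (divg (u t) x) ^ 2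
    + (μ / 2) * curlNormSq (u t) x + θ t x

/-- The `i`-th component of the flux of the total energy. -/
noncomputable def energyFlux {d : ℕ} (μ lam ν : ℝ) (u : ℝ → Ed d → Ed d) (θ : ℝ → Ed d → ℝ)
    (i : Fin d) (t : ℝ) (x : Ed d) : ℝ :=
  (2 * μ + lam) * (divg (u t) x * tder u t x i) - ν * (θ t x * tder u t x i) + pd i (θ t) x
    - μ * ∑ j, curlM (u t) x j i * tder u t x j

/-- Antisymmetry of the curl in its contraction with the curl of another field. -/
theorem sum_curlM_mul_curlM {d : ℕ} (w z : Ed d → Ed d) (x : Ed d) :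
    ∑ i, ∑ j, curlM w x i j * curlM z x i j
      = -2 * ∑ i, ∑ j, curlM w x j i * pd i (fun y => z y j) x := by
  have h1 : ∑ i, ∑ j, curlM w x i j * pd j (fun y => z y i) x
      = ∑ i, ∑ j, curlM w x j i * pd i (fun y => z y j) x := Finset.sum_comm
  have h2 : ∀ i j, curlM w x i j * curlM z x i j = -(curlM w x j i * pd i (fun y => z y j) x)
      - curlM w x i j * pd j (fun y => z y i) x := fun i j => by
    simp only [curlM]
    ring
  simp_rw [h2, Finset.sum_sub_distrib, Finset.sum_neg_distrib, h1]
  ring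

namespace IsSolution

variable {d : ℕ} {Ω : Set (Ed d)} {n : Ed d → Ed d} {μ lam ν : ℝ} {u : ℝ → Ed d → Ed d}
  {θ : ℝ → Ed d → ℝ}

theorem smooth_comp (h : IsSolution Ω n μ lam ν u θ) (i : Fin d) :
    SmoothField fun t x => u t x i :=
  (EuclideanSpace.proj (𝕜 := ℝ) i).contDiff.comp h.smooth_u

theorem hasDerivAt_comp (h : IsSolution Ω n μ lam ν u θ) (t : ℝ) (x : Ed d) (i : Fin d) :
    HasDerivAt (fun s => u s x i) (tder u t x i) t := by
  have hu : DifferentiableAt ℝ (fun s => u s x) t :=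
    ((h.smooth_u.comp (contDiff_id.prodMk contDiff_const)).differentiable (by simp)) t
  exact ((EuclideanSpace.proj (𝕜 := ℝ) i).hasFDerivAt.comp_hasDerivAt t hu.hasDerivAt)

theorem tder_comp (h : IsSolution Ω n μ lam ν u θ) (i : Fin d) :
    tder (fun t x => u t x i) = fun t x => tder u t x i :=
  funext₂ fun t x => (h.hasDerivAt_comp t x i).deriv

theorem smooth_tder (h : IsSolution Ω n μ lam ν u θ) (i : Fin d) :
    SmoothField fun t x => tder u t x i :=
  h.tder_comp i ▸ (h.smooth_comp i).tder

theorem hasDerivAt_tder (h : IsSolution Ω n μ lam ν u θ) (t : ℝ) (x : Ed d) (i : Fin d) :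
    HasDerivAt (fun s => tder u s x i) (tder (tder u) t x i) t := by
  have hd : DifferentiableAt ℝ (fun s => tder u s x) t := by
    rw [differentiableAt_euclidean]
    exact fun j => ((h.smooth_tder j).hasDerivAt t x).differentiableAt
  exact ((EuclideanSpace.proj (𝕜 := ℝ) i).hasFDerivAt.comp_hasDerivAt t hd.hasDerivAt)

theorem smooth_divg (h : IsSolution Ω n μ lam ν u θ) : SmoothField fun t => divg (u t) :=
  SmoothField.sum fun i => (h.smooth_comp i).pd i

theorem smooth_curlM (h : IsSolution Ω n μ lam ν u θ) (i j : Fin d) :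
    SmoothField fun t x => curlM (u t) x i j :=
  ((h.smooth_comp j).pd i).sub ((h.smooth_comp i).pd j)

theorem smooth_curlNormSq (h : IsSolution Ω n μ lam ν u θ) :
    SmoothField fun t => curlNormSq (u t) :=
  (SmoothField.sum fun i => .sum fun j => (h.smooth_curlM i j).pow 2).const_mul _

theorem hasDerivAt_pd (h : IsSolution Ω n μ lam ν u θ) (t : ℝ) (x : Ed d) (i j : Fin d) :
    HasDerivAt (fun s => pd i (fun y => u s y j) x) (pd i (fun y => tder u t y j) x) t := by
  have := ((h.smooth_comp j).pd i).hasDerivAt t x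
  rwa [(h.smooth_comp j).tder_pd, h.tder_comp j] at this

theorem hasDerivAt_divg (h : IsSolution Ω n μ lam ν u θ) (t : ℝ) (x : Ed d) :
    HasDerivAt (fun s => divg (u s) x) (divg (tder u t) x) t :=
  HasDerivAt.fun_sum fun i _ => h.hasDerivAt_pd t x i i

theorem hasDerivAt_curlM (h : IsSolution Ω n μ lam ν u θ) (t : ℝ) (x : Ed d) (i j : Fin d) :
    HasDerivAt (fun s => curlM (u s) x i j) (curlM (tder u t) x i j) t :=
  (h.hasDerivAt_pd t x i j).sub (h.hasDerivAt_pd t x j i)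

theorem smooth_energyDensity (h : IsSolution Ω n μ lam ν u θ) :
    SmoothField (energyDensity μ lam u θ) :=
  ((((SmoothField.sum fun i => (h.smooth_tder i).pow 2).const_mul _).add
    ((h.smooth_divg.pow 2).const_mul _)).add (h.smooth_curlNormSq.const_mul _)).add h.smooth_θ

theorem smooth_energyFlux (h : IsSolution Ω n μ lam ν u θ) (i : Fin d) :
    SmoothField (energyFlux μ lam ν u θ i) :=
  ((((h.smooth_divg.mul (h.smooth_tder i)).const_mul _).sub
    ((SmoothField.mul h.smooth_θ (h.smooth_tder i)).const_mul _)).add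
    (SmoothField.pd h.smooth_θ i)).sub
    ((SmoothField.sum fun j => (h.smooth_curlM j i).mul (h.smooth_tder j)).const_mul _)

theorem tder_energyDensity (h : IsSolution Ω n μ lam ν u θ) (t : ℝ) (x : Ed d) :
    tder (energyDensity μ lam u θ) t x
      = ∑ i, tder u t x i * tder (tder u) t x i
        + (2 * μ + lam) * (divg (u t) x * divg (tder u t) x)
        - μ * ∑ i, ∑ j, curlM (u t) x j i * pd i (fun y => tder u t y j) x + tder θ t x := by
  have h1 := (HasDerivAt.fun_sum (u := Finset.univ)
    fun i _ => (h.hasDerivAt_tder t x i).fun_pow 2).const_mul (1 / 2 : ℝ)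
  have h2 := ((h.hasDerivAt_divg t x).fun_pow 2).const_mul ((2 * μ + lam) / 2)
  have h3 := ((HasDerivAt.fun_sum (u := Finset.univ) fun i _ => HasDerivAt.fun_sum
    (u := Finset.univ) fun j _ =>
      (h.hasDerivAt_curlM t x i j).fun_pow 2).const_mul (1 / 2 : ℝ)).const_mul (μ / 2)
  have h4 := SmoothField.hasDerivAt h.smooth_θ t x
  refine (((h1.add h2).add h3).add h4).deriv.trans ?_
  have hc := sum_curlM_mul_curlM (u t) (tder u t) x
  simp only [Nat.cast_ofNat, Nat.add_one_sub_one, pow_one, mul_assoc, ← Finset.mul_sum]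
  rw [hc]
  ring

theorem pd_energyFlux (h : IsSolution Ω n μ lam ν u θ) (i : Fin d) (t : ℝ) (x : Ed d) :
    pd i (energyFlux μ lam ν u θ i t) x
      = (2 * μ + lam) * (pd i (divg (u t)) x * tder u t x i
          + divg (u t) x * pd i (fun y => tder u t y i) x)
        - ν * (pd i (θ t) x * tder u t x i + θ t x * pd i (fun y => tder u t y i) x)
        + pd i (fun y => pd i (θ t) y) x
        - μ * ∑ j, (pd i (fun y => curlM (u t) y j i) x * tder u t x j
          + curlM (u t) x j i * pd i (fun y => tder u t y j) x) := by
  have hθ : SmoothField θ := h.smooth_θ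
  have hv := fun j => (h.smooth_tder j).differentiableAt_slice t x
  have hD := h.smooth_divg.differentiableAt_slice t x
  have hC := fun j => (h.smooth_curlM j i).differentiableAt_slice t x
  have hT := hθ.differentiableAt_slice t x
  have hP := (hθ.pd i).differentiableAt_slice t x
  have hS := DifferentiableAt.fun_sum (u := Finset.univ) fun j _ => (hC j).fun_mul (hv j)
  have hA := (hD.fun_mul (hv i)).const_mul (2 * μ + lam)
  have hB := (hT.fun_mul (hv i)).const_mul ν
  unfold energyFlux
  rw [pd_sub i ((hA.fun_sub hB).fun_add hP) (hS.const_mul μ), pd_add i (hA.fun_sub hB) hP,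
    pd_sub i hA hB, pd_const_mul i _ (hD.fun_mul (hv i)), pd_const_mul i _ (hT.fun_mul (hv i)),
    pd_const_mul i _ hS, pd_mul i hD (hv i), pd_mul i hT (hv i),
    pd_sum i fun j => (hC j).fun_mul (hv j)]
  simp_rw [fun j => pd_mul i (hC j) (hv j)]

/-- The local form of the energy balance. -/
theorem tder_energyDensity_eq_sum_pd (h : IsSolution Ω n μ lam ν u θ) {t : ℝ} (ht : 0 < t)
    {x : Ed d} (hx : x ∈ Ω) :
    tder (energyDensity μ lam u θ) t x = ∑ i, pd i (energyFlux μ lam ν u θ i t) x := by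
  have hw : ∀ i, tder (tder u) t x i
      = (2 * μ + lam) * pd i (divg (u t)) x - μ * ccurl (u t) x i - ν * pd i (θ t) x :=
    fun i => by linarith [h.wave t ht x hx i]
  have hh : tder θ t x = lap (θ t) x - ν * (θ t x * divg (tder u t) x) := by
    linarith [h.heat t ht x hx]
  have hcc : ∑ i, ∑ j, pd i (fun y => curlM (u t) y j i) x * tder u t x j
      = ∑ i, tder u t x i * ccurl (u t) x i := by
    rw [Finset.sum_comm]
    simp_rw [ccurl, Finset.mul_sum, mul_comm]
  rw [h.tder_energyDensity, hh]
  simp_rw [h.pd_energyFlux, hw, Finset.sum_sub_distrib, Finset.sum_add_distrib,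
    Finset.sum_sub_distrib, ← Finset.mul_sum, Finset.sum_add_distrib, hcc, ← Finset.mul_sum,
    mul_sub, Finset.sum_sub_distrib]
  have e1 : ∑ i, tder u t x i * ((2 * μ + lam) * pd i (divg (u t)) x)
      = (2 * μ + lam) * ∑ i, pd i (divg (u t)) x * tder u t x i := by
    rw [Finset.mul_sum]
    exact Finset.sum_congr rfl fun i _ => by ring
  have e2 : ∑ i, tder u t x i * (μ * ccurl (u t) x i)
      = μ * ∑ i, tder u t x i * ccurl (u t) x i := by
    rw [Finset.mul_sum]
    exact Finset.sum_congr rfl fun i _ => by ring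
  have e3 : ∑ i, tder u t x i * (ν * pd i (θ t) x) = ν * ∑ i, pd i (θ t) x * tder u t x i := by
    rw [Finset.mul_sum]
    exact Finset.sum_congr rfl fun i _ => by ring
  rw [e1, e2, e3]
  simp only [lap, divg]
  ring

/-- The energy flux is tangent to the boundary. -/
theorem sum_energyFlux_mul_normal (h : IsSolution Ω n μ lam ν u θ) {t : ℝ} (ht : 0 < t)
    {x : Ed d} (hx : x ∈ frontier Ω) : ∑ i, energyFlux μ lam ν u θ i t x * n x i = 0 := by
  have hv : ∑ i, tder u t x i * n x i = 0 := by
    have h1 : HasDerivAt (fun s => ∑ i, u s x i * n x i) (∑ i, tder u t x i * n x i) t :=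
      HasDerivAt.fun_sum fun i _ => (h.hasDerivAt_comp t x i).mul_const _
    refine h1.unique ((hasDerivAt_const t (0 : ℝ)).congr_of_eventuallyEq ?_)
    filter_upwards [Ioi_mem_nhds ht] with s hs
    exact h.bc_u s hs x hx
  have hc : ∑ i, (∑ j, curlM (u t) x j i * tder u t x j) * n x i = 0 := by
    simp_rw [Finset.sum_mul]
    rw [Finset.sum_comm]
    refine Finset.sum_eq_zero fun j _ => ?_
    calc ∑ i, curlM (u t) x j i * tder u t x j * n x i
        = tder u t x j * ∑ i, curlM (u t) x j i * n x i := by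
          rw [Finset.mul_sum]
          exact Finset.sum_congr rfl fun i _ => by ring
      _ = 0 := by rw [h.bc_N t ht x hx j, mul_zero]
  calc ∑ i, energyFlux μ lam ν u θ i t x * n x i
      = ((2 * μ + lam) * divg (u t) x - ν * θ t x) * ∑ i, tder u t x i * n x i
        + ∑ i, pd i (θ t) x * n x i
        - μ * ∑ i, (∑ j, curlM (u t) x j i * tder u t x j) * n x i := by
        rw [Finset.mul_sum, Finset.mul_sum, ← Finset.sum_add_distrib, ← Finset.sum_sub_distrib]
        refine Finset.sum_congr rfl fun i _ => ?_
        rw [energyFlux]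
        ring
    _ = 0 := by rw [hv, hc, h.bc_θ t ht x hx]; ring

theorem integral_energyDensity (h : IsSolution Ω n μ lam ν u θ) (hΩ : Bornology.IsBounded Ω)
    (t : ℝ) :
    ∫ x in Ω, energyDensity μ lam u θ t x
      = (1 / 2) * (∫ x in Ω, ∑ i, (tder u t x i) ^ 2)
        + ((2 * μ + lam) / 2) * (∫ x in Ω, (divg (u t) x) ^ 2)
        + (μ / 2) * (∫ x in Ω, curlNormSq (u t) x) + (∫ x in Ω, θ t x) := by
  have h1 := ((SmoothField.sum (s := Finset.univ) fun i => (h.smooth_tder i).pow 2).const_mul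
    (1 / 2)).integrableOn hΩ t
  have h2 := ((h.smooth_divg.pow 2).const_mul ((2 * μ + lam) / 2)).integrableOn hΩ t
  have h3 := (h.smooth_curlNormSq.const_mul (μ / 2)).integrableOn hΩ t
  have h4 := SmoothField.integrableOn h.smooth_θ hΩ t
  unfold energyDensity
  rw [integral_add (by exact (h1.add h2).add h3) h4, integral_add (by exact h1.add h2) h3,
    integral_add h1 h2]
  simp_rw [integral_const_mul]

theorem hasDerivAt_integral_energyDensity (hdom : GoodDomain d Ω n)
    (h : IsSolution Ω n μ lam ν u θ) {t : ℝ} (ht : 0 < t) :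
    HasDerivAt (fun s => ∫ x in Ω, energyDensity μ lam u θ s x) 0 t := by
  convert h.smooth_energyDensity.hasDerivAt_integral hdom.isOpen.measurableSet hdom.bounded t
    using 1
  rw [setIntegral_congr_fun hdom.isOpen.measurableSet
    fun x hx => h.tder_energyDensity_eq_sum_pd ht hx]
  exact (hdom.integral_sum_pd_eq_zero
    (fun i => ((h.smooth_energyFlux i).slice t).of_le (mod_cast le_top))
    fun x hx => h.sum_energyFlux_mul_normal ht hx).symm

end IsSolution

/-- conservation of total energy for smooth solutions. -/
theorem energy_conservation {d : ℕ} {Ω : Set (Ed d)} {n : Ed d → Ed d}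
    {μ lam ν : ℝ} {u : ℝ → Ed d → Ed d} {θ : ℝ → Ed d → ℝ}
    (hdom : GoodDomain d Ω n) (hμ : 0 < μ) (hlam : 0 < 2 * μ + (d : ℝ) * lam)
    (hsol : IsSolution Ω n μ lam ν u θ) :
    ∀ t : ℝ, 0 ≤ t →
      (1 / 2) * (∫ x in Ω, ∑ i, (tder u t x i) ^ 2)
        + ((2 * μ + lam) / 2) * (∫ x in Ω, (divg (u t) x) ^ 2)
        + (μ / 2) * (∫ x in Ω, curlNormSq (u t) x)
        + (∫ x in Ω, θ t x)
      = (1 / 2) * (∫ x in Ω, ∑ i, (tder u 0 x i) ^ 2)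
        + ((2 * μ + lam) / 2) * (∫ x in Ω, (divg (u 0) x) ^ 2)
        + (μ / 2) * (∫ x in Ω, curlNormSq (u 0) x)
        + (∫ x in Ω, θ 0 x) := by
  intro t ht
  rw [← hsol.integral_energyDensity hdom.bounded, ← hsol.integral_energyDensity hdom.bounded]
  rcases ht.eq_or_lt with rfl | ht
  · rfl
  have hcont : Continuous fun s => ∫ x in Ω, energyDensity μ lam u θ s x :=
    continuous_iff_continuousAt.2 fun s => (hsol.smooth_energyDensity.hasDerivAt_integral
      hdom.isOpen.measurableSet hdom.bounded s).continuousAt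
  obtain ⟨c, -, hc⟩ := exists_hasDerivAt_eq_slope _ (fun _ => 0) ht hcont.continuousOn
    fun s hs => hsol.hasDerivAt_integral_energyDensity hdom hs.1
  rw [eq_comm, div_eq_zero_iff, sub_eq_zero] at hc
  exact hc.resolve_right (by linarith)
end

section
/- Suppose v ∈ C²(Ω̄) satisfies the Neumann boundary condition ∂v/∂n = 0 on ∂Ω. Then ∂(|∇v|²)/∂n ≤ 0 at every point of ∂Ω, i.e. the outward normal derivative of the function |∇v|² is nonpositive on the boundary. -/
open MeasureTheory Real Filter Set
open scoped Topology

open scoped RealInnerProductSpace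

lemma IsPreconnected.inter_frontier_nonempty {X : Type*} [TopologicalSpace X] {s t : Set X}
    (ht : IsPreconnected t) (h : (t ∩ s).Nonempty) (h' : (t ∩ sᶜ).Nonempty) :
    (t ∩ frontier s).Nonempty := by
  by_contra hne
  have hfr : ∀ x ∈ t, x ∉ frontier s := fun x hx hxf => hne ⟨x, hx, hxf⟩
  have hint : ∀ x ∈ t, x ∈ closure s → x ∈ interior s := fun x hx hxc =>
    not_not.1 fun hxi => hfr x hx ⟨hxc, hxi⟩
  obtain ⟨x, hx, hxs⟩ := h
  obtain ⟨y, hy, hys⟩ := h'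
  obtain ⟨z, -, hzi, hzc⟩ := ht (interior s) (closure s)ᶜ isOpen_interior
    isClosed_closure.isOpen_compl
    (fun z hz => (em (z ∈ closure s)).imp (hint z hz) id)
    ⟨x, hx, hint x hx (subset_closure hxs)⟩
    ⟨y, hy, fun hyc => hys (interior_subset (hint y hy hyc))⟩
  exact hzc (interior_subset_closure hzi)

section OutwardNormal

variable {E : Type*} [NormedAddCommGroup E] [InnerProductSpace ℝ E] {Ω : Set E} {n G : E → E}

/-- At every point of `∂Ω`, `n` is a unit normal of a half-space supporting `Ω`. No regularity of
the boundary is required: at a corner `n` may be any element of the normal cone. -/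
def IsOutwardUnitNormal (Ω : Set E) (n : E → E) : Prop :=
  ∀ x ∈ frontier Ω, ‖n x‖ = 1 ∧ ∀ z ∈ closure Ω, ⟪z - x, n x⟫ ≤ 0

namespace IsOutwardUnitNormal

lemma inner_center_sub_le (hn : IsOutwardUnitNormal Ω n) {x c : E} {R : ℝ}
    (hx : x ∈ frontier Ω) (hR : 0 < R) (hball : Metric.ball c R ⊆ Ω) : ⟪c - x, n x⟫ ≤ -R := by
  obtain ⟨h1, h2⟩ := hn x hx
  have hmem : c + R • n x ∈ closure Ω := by
    apply closure_mono hball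
    rw [closure_ball c hR.ne']
    simp [norm_smul, h1, abs_of_pos hR]
  have h := h2 _ hmem
  rw [add_sub_right_comm, inner_add_left, real_inner_smul_left, real_inner_self_eq_norm_sq,
    h1] at h
  linarith

lemma inner_sub_neg (hn : IsOutwardUnitNormal Ω n) (hΩ : IsOpen Ω) {x z : E}
    (hx : x ∈ frontier Ω) (hz : z ∈ Ω) : ⟪z - x, n x⟫ < 0 := by
  obtain ⟨r, hr, hball⟩ := Metric.isOpen_iff.1 hΩ z hz
  linarith [hn.inner_center_sub_le hx hr hball]

/-- If an interior ball touches `∂Ω` at `y`, its center lies on the line through `y` along `n y`. -/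
lemma center_eq (hn : IsOutwardUnitNormal Ω n) {y c : E} {R : ℝ} (hy : y ∈ frontier Ω)
    (hR : 0 < R) (hball : Metric.ball c R ⊆ Ω) (hyc : dist y c = R) : c = y - R • n y := by
  have h := hn.inner_center_sub_le hy hR hball
  have h1 := (hn y hy).1
  have h0 : ‖(c - y) + R • n y‖ ^ 2 ≤ 0 := by
    rw [norm_add_sq_real, norm_smul, h1, real_inner_smul_right, ← dist_eq_norm, dist_comm, hyc,
      Real.norm_eq_abs, abs_of_pos hR]
    nlinarith
  have h2 : (c - y) + R • n y = 0 := by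
    rw [← norm_eq_zero]
    exact pow_eq_zero_iff two_ne_zero |>.1 (le_antisymm h0 (sq_nonneg _))
  rw [← sub_eq_zero, ← h2]
  abel

/-- Boundary normals vary with a square-root modulus of continuity at a point touched by an
interior ball. -/
lemma norm_sub_sq_le (hn : IsOutwardUnitNormal Ω n) {y z c : E} {R : ℝ} (hy : y ∈ frontier Ω)
    (hz : z ∈ frontier Ω) (hR : 0 < R) (hball : Metric.ball c R ⊆ Ω) (hyc : dist y c = R) :
    ‖n z - n y‖ ^ 2 ≤ 2 / R * ‖z - y‖ := by
  have hc := hn.center_eq hy hR hball hyc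
  have h := hn.inner_center_sub_le hz hR hball
  have h1 : ⟪z - y, n z⟫ ≤ ‖z - y‖ := by
    simpa [(hn z hz).1] using real_inner_le_norm (z - y) (n z)
  rw [hc, show y - R • n y - z = -(z - y) - R • n y by abel, inner_sub_left, inner_neg_left,
    real_inner_smul_left, real_inner_comm (n z) (n y)] at h
  rw [norm_sub_sq_real, (hn z hz).1, (hn y hy).1, div_mul_eq_mul_div, le_div_iff₀ hR]
  linarith

/-- Near a point touched by an interior ball, the boundary is within quadratic distance of each
tangent line. -/
lemma exists_frontier_near_tangent (hn : IsOutwardUnitNormal Ω n) (hΩ : IsOpen Ω) {y c w : E}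
    {R : ℝ} (hy : y ∈ frontier Ω) (hR : 0 < R) (hball : Metric.ball c R ⊆ Ω) (hyc : dist y c = R)
    (hw : ⟪w, n y⟫ = 0) :
    ∃ K : ℝ, 0 < K ∧ ∃ t₀ : ℝ, 0 < t₀ ∧ ∀ t ∈ Ico 0 t₀, ∃ s ∈ Icc 0 (K * t ^ 2),
      y + t • w - s • n y ∈ frontier Ω := by
  have hc := hn.center_eq hy hR hball hyc
  have h1 := (hn y hy).1
  have hK : 0 < (‖w‖ ^ 2 + 1) / R := by positivity
  set K := (‖w‖ ^ 2 + 1) / R with hKdef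
  have hKR : K * R = ‖w‖ ^ 2 + 1 := by rw [hKdef]; field_simp
  refine ⟨K, hK, 1 / K, by positivity, fun t ⟨ht0, ht1⟩ => ?_⟩
  rcases ht0.eq_or_lt with rfl | ht
  · exact ⟨0, by simp, by simpa using hy⟩
  let γ : ℝ → E := fun s => y + t • w - s • n y
  have hγ : Continuous γ := by fun_prop
  have hin : γ (K * t ^ 2) ∈ Ω := by
    apply hball
    rw [mem_ball_iff_norm, ← sq_lt_sq₀ (norm_nonneg _) hR.le, hc,
      show γ (K * t ^ 2) - (y - R • n y) = t • w + (R - K * t ^ 2) • n y by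
        simp only [γ]; module,
      norm_add_sq_real, norm_smul, norm_smul, real_inner_smul_left, real_inner_smul_right, hw, h1,
      mul_pow, mul_pow, Real.norm_eq_abs, Real.norm_eq_abs, sq_abs, sq_abs]
    have hKt : (K * t) ^ 2 < 1 := by
      rw [lt_div_iff₀ hK] at ht1
      have : 0 < K * t := by positivity
      nlinarith
    have ht2 : 0 < t ^ 2 := by positivity
    have : t ^ 2 * (2 * (K * R)) > t ^ 2 * (‖w‖ ^ 2 + (K * t) ^ 2) := by
      apply mul_lt_mul_of_pos_left _ ht2
      rw [hKR]
      nlinarith [sq_nonneg ‖w‖]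
    nlinarith
  have hout : γ 0 ∉ Ω := fun h => by
    have := hn.inner_sub_neg hΩ hy h
    simp [γ, real_inner_smul_left, hw] at this
  have hpre : IsPreconnected (γ '' Icc 0 (K * t ^ 2)) :=
    isPreconnected_Icc.image γ hγ.continuousOn
  have hKt : 0 ≤ K * t ^ 2 := by positivity
  obtain ⟨_, ⟨s, hs, rfl⟩, hfr⟩ : (γ '' Icc 0 (K * t ^ 2) ∩ frontier Ω).Nonempty :=
    hpre.inter_frontier_nonempty ⟨_, ⟨_, right_mem_Icc.2 hKt, rfl⟩, hin⟩
      ⟨_, ⟨_, left_mem_Icc.2 hKt, rfl⟩, hout⟩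
  exact ⟨s, hs, hfr⟩

/-- The sign condition at boundary points touched by an interior ball. -/
lemma inner_fderiv_nonpos_of_interior_ball (hn : IsOutwardUnitNormal Ω n) (hΩ : IsOpen Ω)
    (hG : ∀ x ∈ frontier Ω, ⟪G x, n x⟫ = 0) {y c : E} {R : ℝ} (hd : DifferentiableAt ℝ G y)
    (hy : y ∈ frontier Ω) (hR : 0 < R) (hball : Metric.ball c R ⊆ Ω) (hyc : dist y c = R) :
    ⟪fderiv ℝ G y (G y), n y⟫ ≤ 0 := by
  obtain ⟨K, hK, t₀, ht₀, hs⟩ :=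
    hn.exists_frontier_near_tangent hΩ hy hR hball hyc (hG y hy)
  choose! s hsK hfr using hs
  have hIco : Ico 0 t₀ ∈ 𝓝[≥] (0 : ℝ) := Ico_mem_nhdsGE ht₀
  have hs0 : s 0 = 0 := by simpa using hsK 0 (left_mem_Ico.2 ht₀)
  have hsd : HasDerivWithinAt s 0 (Ici 0) 0 := by
    rw [hasDerivWithinAt_iff_isLittleO]
    have hO : (fun t => s t - s 0 - (t - 0) • (0 : ℝ)) =O[𝓝[≥] 0] fun t : ℝ => t ^ 2 := by
      refine Asymptotics.IsBigO.of_bound K ?_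
      filter_upwards [hIco] with t ht
      have := hsK t ht
      simpa [hs0, abs_of_nonneg this.1] using this.2
    refine hO.trans_isLittleO ?_
    simpa using (Asymptotics.isLittleO_pow_id (𝕜 := ℝ) one_lt_two).mono nhdsWithin_le_nhds
  let z : ℝ → E := fun t => y + t • G y - s t • n y
  have hz0 : z 0 = y := by simp [z, hs0]
  have hzd : HasDerivWithinAt z (G y) (Ici 0) 0 := by
    simpa [z] using (((hasDerivWithinAt_id (0 : ℝ) (Ici 0)).smul_const (G y)).const_add y).fun_sub
      (hsd.smul_const (n y))
  have hGz : HasDerivWithinAt (G ∘ z) (fderiv ℝ G y (G y)) (Ici 0) 0 :=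
    hd.hasFDerivAt.comp_hasDerivWithinAt_of_eq 0 hzd hz0.symm
  have hslope : Tendsto (slope (G ∘ z) 0) (𝓝[>] 0) (𝓝 (fderiv ℝ G y (G y))) := by
    have := hasDerivWithinAt_iff_tendsto_slope.1 hGz
    rwa [Ici_sdiff_left] at this
  have hIoo : Ioo 0 t₀ ∈ 𝓝[>] (0 : ℝ) := Ioo_mem_nhdsGT ht₀
  have hzt : Tendsto z (𝓝[>] 0) (𝓝 y) := by
    have := hzd.continuousWithinAt.tendsto
    rw [hz0] at this
    exact this.mono_left (nhdsWithin_mono _ Ioi_subset_Ici_self)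
  have hnz : Tendsto (fun t => n (z t)) (𝓝[>] 0) (𝓝 (n y)) := by
    rw [tendsto_iff_norm_sub_tendsto_zero]
    have hb : Tendsto (fun t => √(2 / R * ‖z t - y‖)) (𝓝[>] 0) (𝓝 0) := by
      have := ((tendsto_iff_norm_sub_tendsto_zero.1 hzt).const_mul (2 / R)).sqrt
      simpa using this
    refine squeeze_zero' (Eventually.of_forall fun _ => norm_nonneg _) ?_ hb
    filter_upwards [hIoo] with t ht
    exact Real.le_sqrt_of_sq_le
      (hn.norm_sub_sq_le hy (hfr t ⟨ht.1.le, ht.2⟩) hR hball hyc)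
  have hpos : ∀ᶠ t in 𝓝[>] (0 : ℝ), 0 < ⟪n y, n (z t)⟫ := by
    have : Tendsto (fun t => ⟪n y, n (z t)⟫) (𝓝[>] 0) (𝓝 ⟪n y, n y⟫) :=
      tendsto_const_nhds.inner hnz
    refine this.eventually (lt_mem_nhds ?_)
    simp [(hn y hy).1]
  refine le_of_tendsto (hslope.inner hnz) ?_
  filter_upwards [hIoo, hpos] with t ht hp
  have htm : t ∈ Ico 0 t₀ := ⟨ht.1.le, ht.2⟩
  have hzf : z t ∈ frontier Ω := hfr t htm
  have hsupp := (hn _ hzf).2 y (frontier_subset_closure hy)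
  rw [show y - z t = s t • n y - t • G y by simp only [z]; abel, inner_sub_left,
    real_inner_smul_left, real_inner_smul_left] at hsupp
  have hw : 0 ≤ ⟪G y, n (z t)⟫ := by
    have := mul_nonneg (hsK t htm).1 hp.le
    by_contra! hneg
    nlinarith [mul_neg_of_pos_of_neg ht.1 hneg]
  rw [slope_def_module, real_inner_smul_left, Function.comp_apply, Function.comp_apply, hz0,
    inner_sub_left, hG _ hzf, sub_zero]
  exact mul_nonpos_of_nonneg_of_nonpos (inv_nonneg.2 ht.1.le) (by linarith)

/-- For a direction `u` making an acute angle with the normal at `x`, there are arbitrarily close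
boundary points which are touched by interior balls and whose normals make uniformly acute angles
with `u`. -/
lemma exists_interior_ball_touching [ProperSpace E] (hn : IsOutwardUnitNormal Ω n)
    (hΩ : IsOpen Ω) (hconv : Convex ℝ Ω) {x u : E} (hx : x ∈ frontier Ω) (hne : Ω.Nonempty)
    (hu : 0 < ⟪u, n x⟫) :
    ∃ δ > 0, ∀ ε > 0, ∃ y ∈ frontier Ω, dist y x < ε ∧ δ ≤ ⟪u, n y⟫ ∧
      ∃ c R, 0 < R ∧ Metric.ball c R ⊆ Ω ∧ dist y c = R := by
  obtain ⟨p, hp⟩ := hne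
  obtain ⟨ρ, hρ, hpball⟩ := Metric.isOpen_iff.1 hΩ p hp
  obtain ⟨a, ha⟩ : ∃ a, a = -⟪p - x, n x⟫ := ⟨_, rfl⟩
  have ha0 : 0 < a := by linarith [hn.inner_sub_neg hΩ hx hp]
  set κ := ⟪u, n x⟫ / (2 * a) with hκ
  have hκ0 : 0 < κ := by positivity
  set u' := u + κ • (p - x) with hu'
  set b := ⟪u', n x⟫ with hb
  have hb0 : 0 < b := by
    have : b = ⟪u, n x⟫ / 2 := by
      rw [hb, hu', inner_add_left, real_inner_smul_left, hκ, show ⟪p - x, n x⟫ = -a by linarith]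
      field_simp
      ring
    linarith
  set T := a / b with hT
  have hT0 : 0 < T := by positivity
  set M := ρ + ‖p - x‖ + T * ‖u'‖ with hM
  have hM0 : 0 < M := by positivity
  refine ⟨κ * (ρ / 2), by positivity, fun ε hε => ?_⟩
  obtain ⟨l, hl0, hl1, hlε, hlρ⟩ :
      ∃ l : ℝ, 0 < l ∧ l ≤ 1 ∧ l * M < ε ∧ l * M ≤ ρ / 2 := by
    refine ⟨min 1 (min (ε / (2 * M)) (ρ / (2 * M))), by positivity, min_le_left _ _, ?_, ?_⟩
    · calc _ ≤ ε / (2 * M) * M := by gcongr; exact (min_le_right _ _).trans (min_le_left _ _)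
        _ = ε / 2 := by field_simp
        _ < ε := by linarith
    · calc _ ≤ ρ / (2 * M) * M := by gcongr; exact (min_le_right _ _).trans (min_le_right _ _)
        _ = ρ / 2 := by field_simp
  let C : ℝ → E := fun τ => x + l • (p - x) + (l * τ) • u'
  have hC : Continuous C := by fun_prop
  have hlρ0 : 0 < l * ρ := by positivity
  have hC0 : Metric.ball (C 0) (l * ρ) ⊆ Ω := fun q hq => by
    have hq' : x + l⁻¹ • (q - x) ∈ interior Ω := by
      rw [hΩ.interior_eq]
      apply hpball
      rw [mem_ball_iff_norm] at hq ⊢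
      rw [show x + l⁻¹ • (q - x) - p = l⁻¹ • (q - C 0) by
        simp only [C, mul_zero, zero_smul, add_zero, smul_sub, smul_add, inv_smul_smul₀ hl0.ne']
        abel, norm_smul, norm_inv, Real.norm_eq_abs, abs_of_pos hl0, inv_mul_lt_iff₀ hl0]
      exact hq
    have := hconv.add_smul_sub_mem_interior' (frontier_subset_closure hx) hq' ⟨hl0, hl1⟩
    rw [hΩ.interior_eq, add_sub_cancel_left, smul_inv_smul₀ hl0.ne'] at this
    simpa using this
  have hCT : C T ∉ Ω := fun h => by
    have := hn.inner_sub_neg hΩ hx h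
    rw [show C T - x = l • ((p - x) + T • u') by simp only [C]; module, real_inner_smul_left,
      inner_add_left, real_inner_smul_left, ← hb, show ⟪p - x, n x⟫ = -a by linarith, hT,
      div_mul_cancel₀ _ hb0.ne'] at this
    simp at this
  have hcne : (Ωᶜ).Nonempty := ⟨_, hCT⟩
  have hIVT : l * ρ / 2 ∈ (fun τ => Metric.infDist (C τ) Ωᶜ) '' Icc 0 T := by
    apply intermediate_value_Icc' hT0.le
      ((Metric.continuous_infDist_pt _).comp hC).continuousOn
    constructor
    · simp only [Function.comp_apply, Metric.infDist_zero_of_mem (show C T ∈ Ωᶜ from hCT)]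
      positivity
    · refine le_trans (by linarith : l * ρ / 2 ≤ l * ρ) ((Metric.le_infDist hcne).2 ?_)
      intro q hq
      by_contra! hlt
      exact hq (hC0 (by rwa [Metric.mem_ball, dist_comm]))
  obtain ⟨τ, ⟨hτ0, hτT⟩, hτ⟩ := hIVT
  have hτ : Metric.infDist (C τ) Ωᶜ = l * ρ / 2 := hτ
  have hball : Metric.ball (C τ) (l * ρ / 2) ⊆ Ω := hτ ▸ Metric.ball_infDist_compl_subset
  obtain ⟨y, hyΩ, hy⟩ := hΩ.isClosed_compl.exists_infDist_eq_dist hcne (C τ)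
  have hyC : dist y (C τ) = l * ρ / 2 := by rw [dist_comm, ← hy, hτ]
  have hyf : y ∈ frontier Ω := by
    refine ⟨closure_mono hball ?_, fun h => hyΩ (interior_subset h)⟩
    rw [closure_ball _ (by positivity)]
    exact hyC.le
  have hyx : ‖y - x‖ ≤ l * M := by
    calc ‖y - x‖ = ‖(y - C τ) + l • ((p - x) + τ • u')‖ := by
          congr 1; simp only [C]; module
      _ ≤ l * ρ / 2 + l * (‖p - x‖ + τ * ‖u'‖) := by
          refine (norm_add_le _ _).trans (add_le_add (dist_eq_norm y (C τ) ▸ hyC.le) ?_)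
          rw [norm_smul, Real.norm_eq_abs, abs_of_pos hl0]
          gcongr
          refine (norm_add_le _ _).trans ?_
          rw [norm_smul, Real.norm_eq_abs, abs_of_nonneg hτ0]
      _ ≤ l * ρ + l * (‖p - x‖ + T * ‖u'‖) := by gcongr; linarith
      _ = l * M := by rw [hM]; ring
  have h1 := (hn y hyf).1
  have hup : 0 < ⟪u', n y⟫ := by
    have hA := hn.inner_center_sub_le hyf hlρ0 hC0
    have hB : ⟪y - C τ, n y⟫ ≤ l * ρ / 2 := by
      simpa [h1, ← dist_eq_norm, hyC] using real_inner_le_norm (y - C τ) (n y)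
    have hD : (l * τ) * ⟪u', n y⟫ = -⟪y - C τ, n y⟫ - ⟪C 0 - y, n y⟫ := by
      rw [← real_inner_smul_left, ← inner_neg_left, ← inner_sub_left]
      congr 1
      simp only [C]
      module
    have hpos : 0 < (l * τ) * ⟪u', n y⟫ := by linarith
    exact pos_of_mul_pos_right hpos (by positivity)
  refine ⟨y, hyf, by rw [dist_eq_norm]; linarith, ?_, C τ, l * ρ / 2, by positivity, hball, hyC⟩
  have hA := hn.inner_center_sub_le hyf hρ hpball
  have hB : ⟪y - x, n y⟫ ≤ ‖y - x‖ := by simpa [h1] using real_inner_le_norm (y - x) (n y)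
  have hE : ⟪p - x, n y⟫ ≤ -(ρ / 2) := by
    rw [show p - x = (p - y) + (y - x) by abel, inner_add_left]
    linarith
  rw [hu', inner_add_left, real_inner_smul_left] at hup
  nlinarith

/-- If a `C¹` vector field `G` is tangential along the boundary of an open convex set, then the
derivative of `G` along itself has nonpositive normal component there. -/
theorem inner_fderiv_nonpos [ProperSpace E] (hn : IsOutwardUnitNormal Ω n)
    (hΩ : IsOpen Ω) (hconv : Convex ℝ Ω) (hne : Ω.Nonempty) (hGd : ContDiff ℝ 1 G)
    (hG : ∀ x ∈ frontier Ω, ⟪G x, n x⟫ = 0) {x : E} (hx : x ∈ frontier Ω) :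
    ⟪fderiv ℝ G x (G x), n x⟫ ≤ 0 := by
  by_contra! hu
  obtain ⟨δ, hδ, h⟩ := hn.exists_interior_ball_touching hΩ hconv hx hne hu
  have hcont : Continuous fun q => fderiv ℝ G q (G q) :=
    (hGd.continuous_fderiv one_ne_zero).clm_apply hGd.continuous
  obtain ⟨ε, hε, hclose⟩ := Metric.continuous_iff.1 hcont x δ hδ
  obtain ⟨y, hy, hyx, hyu, c, R, hR, hball, hyc⟩ := h ε hε
  have hneg := hn.inner_fderiv_nonpos_of_interior_ball hΩ hG
    (hGd.differentiable one_ne_zero y) hy hR hball hyc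
  have hd := hclose y hyx
  rw [dist_comm, dist_eq_norm] at hd
  have hle := real_inner_le_norm (fderiv ℝ G x (G x) - fderiv ℝ G y (G y)) (n y)
  rw [(hn y hy).1, mul_one, inner_sub_left] at hle
  linarith

end IsOutwardUnitNormal

end OutwardNormal

section Gradient

variable {E : Type*} [NormedAddCommGroup E] [InnerProductSpace ℝ E] [CompleteSpace E]

lemma ContDiff.gradient_one {v : E → ℝ} (hv : ContDiff ℝ 2 v) : ContDiff ℝ 1 (gradient v) :=
  (InnerProductSpace.toDual ℝ E).symm.contDiff.comp (hv.fderiv_right (by norm_num))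

lemma inner_fderiv_gradient (v : E → ℝ) (x a b : E) :
    ⟪fderiv ℝ (gradient v) x a, b⟫ = fderiv ℝ (fderiv ℝ v) x a b := by
  have h : gradient v = (InnerProductSpace.toDual ℝ E).symm ∘ fderiv ℝ v := rfl
  rw [h, LinearIsometryEquiv.comp_fderiv]
  exact InnerProductSpace.toDual_symm_apply

lemma fderiv_norm_gradient_sq {v : E → ℝ} (hv : ContDiff ℝ 2 v) (x a : E) :
    fderiv ℝ (fun y => ‖gradient v y‖ ^ 2) x a =
      2 * ⟪fderiv ℝ (gradient v) x (gradient v x), a⟫ := by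
  have hd := (hv.gradient_one.differentiable one_ne_zero x).hasFDerivAt
  have hsymm : IsSymmSndFDerivAt ℝ v x := hv.contDiffAt.isSymmSndFDerivAt (by simp)
  rw [hd.norm_sq.fderiv, inner_fderiv_gradient, hsymm, ← inner_fderiv_gradient]
  simp

end Gradient

lemma sum_pd_mul {d : ℕ} (f : Ed d → ℝ) (x a : Ed d) : ∑ i, pd i f x * a i = fderiv ℝ f x a := by
  conv_rhs => rw [← (EuclideanSpace.basisFun (Fin d) ℝ).sum_repr a, map_sum]
  simp [pd, mul_comm]

lemma gradNormSq_eq_norm_gradient_sq {d : ℕ} (f : Ed d → ℝ) (x : Ed d) :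
    gradNormSq f x = ‖gradient f x‖ ^ 2 := by
  rw [EuclideanSpace.real_norm_sq_eq]
  refine Finset.sum_congr rfl fun i _ => ?_
  rw [pd, ← inner_gradient_left, EuclideanSpace.inner_single_right]
  simp

lemma GoodDomain.isOutwardUnitNormal {d : ℕ} {Ω : Set (Ed d)} {n : Ed d → Ed d}
    (h : GoodDomain d Ω n) : IsOutwardUnitNormal Ω n := fun x hx =>
  ⟨h.normal_unit x hx, fun z hz => by
    simpa [PiLp.inner_apply, mul_comm] using h.normal_outward x hx z hz⟩

/-- for `v ∈ C²(Ω̄)` with `∂v/∂n = 0` on `∂Ω` (`Ω` convex), the outward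
normal derivative of `|∇v|²` is nonpositive on the boundary. -/
theorem normal_deriv_gradsq_nonpos {d : ℕ} {Ω : Set (Ed d)} {n : Ed d → Ed d}
    (hdom : GoodDomain d Ω n) (v : Ed d → ℝ) (hv : ContDiff ℝ 2 v)
    (hbc : ∀ x ∈ frontier Ω, ∑ i, pd i v x * n x i = 0) :
    ∀ x ∈ frontier Ω, ∑ i, pd i (fun y => gradNormSq v y) x * n x i ≤ 0 := by
  intro x hx
  rw [sum_pd_mul]
  simp only [gradNormSq_eq_norm_gradient_sq]
  rw [fderiv_norm_gradient_sq hv]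
  have h := hdom.isOutwardUnitNormal.inner_fderiv_nonpos hdom.isOpen hdom.convex hdom.nonempty
    hv.gradient_one (fun y hy => by rw [inner_gradient_left, ← sum_pd_mul, hbc y hy]) hx
  linarith
end
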